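/- arXiv:2605.26474 — 4 statements merged into one kernel-verified Lean document; each statement's English description precedes it below -/
import Mathlib

section
/- Define seven predicates on quadruples of real numbers (l_i, r_i, l_q, r_q): P₁ := (l_i ≤ l_q ∧ l_q ≤ r_i ∧ r_i ≤ r_q), P₂ := (l_i ≤ l_q ∧ l_q ≤ r_q ∧ r_q ≤ r_i), P₃ := (l_q ≤ l_i ∧ l_i ≤ r_q ∧ r_q ≤ r_i), P₄ := (l_q ≤ l_i ∧ l_i ≤ r_i ∧ r_i ≤ r_q), Q₁₂ := (l_i ≤ l_q ∧ l_q ≤ r_i), Q₂₃ := (l_i ≤ r_q ∧ r_q ≤ r_i), Q₃₄ := (l_q ≤ l_i ∧ l_i ≤ r_q ∧ l_q ≤ r_i). Then for every nonempty subset S of {1,2,3,4} there exist two predicates f and g from the list (P₁, P₂, P₃, P₄, Q₁₂, Q₂₃, Q₃₄) such that for all real numbers l_i ≤ r_i and l_q ≤ r_q, the disjunction ⋁_{c ∈ S} P_c holds if and only if f(l_i, r_i, l_q, r_q) ∨ g(l_i, r_i, l_q, r_q) holds. -/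
def P₁ (li ri lq rq : ℝ) : Prop := li ≤ lq ∧ lq ≤ ri ∧ ri ≤ rq

def P₂ (li ri lq rq : ℝ) : Prop := li ≤ lq ∧ lq ≤ rq ∧ rq ≤ ri

def P₃ (li ri lq rq : ℝ) : Prop := lq ≤ li ∧ li ≤ rq ∧ rq ≤ ri

def P₄ (li ri lq rq : ℝ) : Prop := lq ≤ li ∧ li ≤ ri ∧ ri ≤ rq

def Q₁₂ (li ri lq _rq : ℝ) : Prop := li ≤ lq ∧ lq ≤ ri

def Q₂₃ (li ri _lq rq : ℝ) : Prop := li ≤ rq ∧ rq ≤ ri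

def Q₃₄ (li ri lq rq : ℝ) : Prop := lq ≤ li ∧ li ≤ rq ∧ lq ≤ ri

def atomicRR : Fin 4 → ℝ → ℝ → ℝ → ℝ → Prop
  | 0 => P₁
  | 1 => P₂
  | 2 => P₃
  | 3 => P₄

theorem Q₁₂_iff {li ri lq rq : ℝ} (hq : lq ≤ rq) :
    Q₁₂ li ri lq rq ↔ P₁ li ri lq rq ∨ P₂ li ri lq rq := by
  unfold Q₁₂ P₁ P₂
  grind

theorem Q₂₃_iff {li ri lq rq : ℝ} (hq : lq ≤ rq) :
    Q₂₃ li ri lq rq ↔ P₂ li ri lq rq ∨ P₃ li ri lq rq := by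
  unfold Q₂₃ P₂ P₃
  grind

theorem Q₃₄_iff {li ri lq rq : ℝ} (hi : li ≤ ri) :
    Q₃₄ li ri lq rq ↔ P₃ li ri lq rq ∨ P₄ li ri lq rq := by
  unfold Q₃₄ P₃ P₄
  grind

theorem exists_mem_atomicRR_iff (S : Finset (Fin 4)) (li ri lq rq : ℝ) :
    (∃ c ∈ S, atomicRR c li ri lq rq) ↔
      (0 ∈ S ∧ P₁ li ri lq rq) ∨ (1 ∈ S ∧ P₂ li ri lq rq) ∨
        (2 ∈ S ∧ P₃ li ri lq rq) ∨ (3 ∈ S ∧ P₄ li ri lq rq) := by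
  simp [Fin.exists_fin_succ, atomicRR]

theorem stmt_4 :
    ∀ S : Finset (Fin 4), S.Nonempty →
      ∃ f ∈ [P₁, P₂, P₃, P₄, Q₁₂, Q₂₃, Q₃₄],
        ∃ g ∈ [P₁, P₂, P₃, P₄, Q₁₂, Q₂₃, Q₃₄],
          ∀ li ri lq rq : ℝ, li ≤ ri → lq ≤ rq →
            ((∃ c ∈ S, atomicRR c li ri lq rq) ↔
              (f li ri lq rq ∨ g li ri lq rq)) := by
  intro S hS
  have hne : 0 ∈ S ∨ 1 ∈ S ∨ 2 ∈ S ∨ 3 ∈ S := by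
    obtain ⟨c, hc⟩ := hS
    fin_cases c <;> simp_all
  simp only [exists_mem_atomicRR_iff]
  by_cases h₀ : 0 ∈ S <;> by_cases h₁ : 1 ∈ S <;> by_cases h₂ : 2 ∈ S <;> by_cases h₃ : 3 ∈ S <;>
    simp only [h₀, h₁, h₂, h₃, true_and, false_and, or_false, false_or] at hne ⊢
  · refine ⟨Q₁₂, by simp, Q₃₄, by simp, fun li ri lq rq hi hq => ?_⟩
    grind [Q₁₂_iff, Q₂₃_iff, Q₃₄_iff]
  · refine ⟨P₁, by simp, Q₂₃, by simp, fun li ri lq rq hi hq => ?_⟩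
    grind [Q₁₂_iff, Q₂₃_iff, Q₃₄_iff]
  · refine ⟨P₄, by simp, Q₁₂, by simp, fun li ri lq rq hi hq => ?_⟩
    grind [Q₁₂_iff, Q₂₃_iff, Q₃₄_iff]
  · refine ⟨P₁, by simp, P₂, by simp, fun li ri lq rq hi hq => ?_⟩
    grind [Q₁₂_iff, Q₂₃_iff, Q₃₄_iff]
  · refine ⟨P₁, by simp, Q₃₄, by simp, fun li ri lq rq hi hq => ?_⟩
    grind [Q₁₂_iff, Q₂₃_iff, Q₃₄_iff]
  · refine ⟨P₁, by simp, P₃, by simp, fun li ri lq rq hi hq => ?_⟩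
    grind [Q₁₂_iff, Q₂₃_iff, Q₃₄_iff]
  · refine ⟨P₁, by simp, P₄, by simp, fun li ri lq rq hi hq => ?_⟩
    grind [Q₁₂_iff, Q₂₃_iff, Q₃₄_iff]
  · refine ⟨P₁, by simp, P₁, by simp, fun li ri lq rq hi hq => ?_⟩
    grind [Q₁₂_iff, Q₂₃_iff, Q₃₄_iff]
  · refine ⟨P₂, by simp, Q₃₄, by simp, fun li ri lq rq hi hq => ?_⟩
    grind [Q₁₂_iff, Q₂₃_iff, Q₃₄_iff]
  · refine ⟨P₂, by simp, P₃, by simp, fun li ri lq rq hi hq => ?_⟩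
    grind [Q₁₂_iff, Q₂₃_iff, Q₃₄_iff]
  · refine ⟨P₂, by simp, P₄, by simp, fun li ri lq rq hi hq => ?_⟩
    grind [Q₁₂_iff, Q₂₃_iff, Q₃₄_iff]
  · refine ⟨P₂, by simp, P₂, by simp, fun li ri lq rq hi hq => ?_⟩
    grind [Q₁₂_iff, Q₂₃_iff, Q₃₄_iff]
  · refine ⟨P₃, by simp, P₄, by simp, fun li ri lq rq hi hq => ?_⟩
    grind [Q₁₂_iff, Q₂₃_iff, Q₃₄_iff]
  · refine ⟨P₃, by simp, P₃, by simp, fun li ri lq rq hi hq => ?_⟩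
    grind [Q₁₂_iff, Q₂₃_iff, Q₃₄_iff]
  · refine ⟨P₄, by simp, P₄, by simp, fun li ri lq rq hi hq => ?_⟩
    grind [Q₁₂_iff, Q₂₃_iff, Q₃₄_iff]
end

section
/- Let l_i, r_i, l_q, r_q be real numbers with l_q < r_q and l_i < r_i (proper, nondegenerate intervals), and set X = [l_q, r_q], Y = [l_i, r_i]. Then the disjunction of the eleven Allen base relations — m: r_q = l_i; mi: r_i = l_q; o: l_q < l_i < r_q < r_i; oi: l_i < l_q < r_i < r_q; s: l_q = l_i < r_q < r_i; si: l_i = l_q < r_i < r_q; d: l_i < l_q < r_q < r_i; di: l_q < l_i < r_i < r_q; f: l_i < l_q < r_q = r_i; fi: l_q < l_i < r_i = r_q; =: l_i = l_q ∧ r_i = r_q — holds if and only if at least one of the four atomic RR predicates ①, ②, ③, ④ holds. -/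
theorem stmt_10 (li ri lq rq : ℝ) (hi : li < ri) (hq : lq < rq) :
    (rq = li ∨ ri = lq ∨
      (lq < li ∧ li < rq ∧ rq < ri) ∨ (li < lq ∧ lq < ri ∧ ri < rq) ∨
      (lq = li ∧ rq < ri) ∨ (li = lq ∧ ri < rq) ∨
      (li < lq ∧ lq < rq ∧ rq < ri) ∨ (lq < li ∧ li < ri ∧ ri < rq) ∨
      (li < lq ∧ lq < rq ∧ rq = ri) ∨ (lq < li ∧ li < ri ∧ ri = rq) ∨
      (li = lq ∧ ri = rq)) ↔
    ((li ≤ lq ∧ lq ≤ ri ∧ ri ≤ rq) ∨ (li ≤ lq ∧ lq ≤ rq ∧ rq ≤ ri) ∨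
      (lq ≤ li ∧ li ≤ rq ∧ rq ≤ ri) ∨ (lq ≤ li ∧ li ≤ ri ∧ ri ≤ rq)) := by
  grind
end

section
/- Let l_q, r_q be real numbers with l_q < r_q, and let S ⊆ ℝ × ℝ be the set of pairs (l, r) satisfying the disjunction ① ∨ ③ of atomic RR predicates, i.e., S = { (l, r) : (l ≤ l_q ∧ l_q ≤ r ∧ r ≤ r_q) ∨ (l_q ≤ l ∧ l ≤ r_q ∧ r_q ≤ r) }. Then S is not an axis-aligned rectangle: there do not exist sets A, B ⊆ ℝ such that S = A ×ˢ B (the Cartesian product of A and B). -/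
theorem stmt_11 (lq rq : ℝ) (hq : lq < rq) :
    ¬ ∃ A B : Set ℝ,
      {p : ℝ × ℝ | (p.1 ≤ lq ∧ lq ≤ p.2 ∧ p.2 ≤ rq) ∨ (lq ≤ p.1 ∧ p.1 ≤ rq ∧ rq ≤ p.2)}
        = A ×ˢ B := by
  rintro ⟨A, B, h⟩
  have hl : (lq, lq) ∈ A ×ˢ B := h ▸ Or.inl ⟨le_rfl, le_rfl, hq.le⟩
  have hr : (rq, rq) ∈ A ×ˢ B := h ▸ Or.inr ⟨hq.le, le_rfl, le_rfl⟩
  have hm : (rq, lq) ∈ A ×ˢ B := ⟨hr.1, hl.2⟩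
  rw [← h] at hm
  rcases hm with hm | hm
  · exact hq.not_ge hm.1
  · exact hq.not_ge hm.2.2
end

section
/- For every natural number k and all natural numbers a, b with a ≤ b and b ≤ 2^k, there exists a finite set F of pairs (i, j) of natural numbers such that: (1) the cardinality of F is at most 2k + 1; (2) for every (i, j) ∈ F, (j+1)·2^i ≤ 2^k; (3) the dyadic intervals Ico (j·2^i) ((j+1)·2^i) for distinct (i, j) ∈ F are pairwise disjoint; and (4) the union of these intervals over all (i, j) ∈ F equals the interval Ico a b. (Canonical segment-tree decomposition: any query range over 2^k leaves is covered by O(k) = O(log |A|) tree nodes.) -/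
/-- The finite set `F` of segment-tree nodes `(i, j)`, all lying within the first `N` leaves,
partitions the range `[a, b)`. -/
structure IsDyadicPartition (N : ℕ) (F : Finset (ℕ × ℕ)) (a b : ℕ) : Prop where
  le_size : ∀ p ∈ F, (p.2 + 1) * 2 ^ p.1 ≤ N
  unique : ∀ p ∈ F, ∀ q ∈ F, ∀ x, x ∈ Set.Ico (p.2 * 2 ^ p.1) ((p.2 + 1) * 2 ^ p.1) →
    x ∈ Set.Ico (q.2 * 2 ^ q.1) ((q.2 + 1) * 2 ^ q.1) → p = q
  cover : ∀ x, (∃ p ∈ F, x ∈ Set.Ico (p.2 * 2 ^ p.1) ((p.2 + 1) * 2 ^ p.1)) ↔ x ∈ Set.Ico a b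

namespace IsDyadicPartition

theorem union {N a b c : ℕ} {F G : Finset (ℕ × ℕ)} (hab : a ≤ b) (hbc : b ≤ c)
    (hF : IsDyadicPartition N F a b) (hG : IsDyadicPartition N G b c) :
    IsDyadicPartition N (F ∪ G) a c where
  le_size p hp := (Finset.mem_union.1 hp).elim (hF.le_size p) (hG.le_size p)
  unique p hp q hq x hxp hxq := by
    rcases Finset.mem_union.1 hp with hp | hp <;> rcases Finset.mem_union.1 hq with hq | hq
    · exact hF.unique p hp q hq x hxp hxq
    · exact absurd ((hF.cover x).1 ⟨p, hp, hxp⟩).2 ((hG.cover x).1 ⟨q, hq, hxq⟩).1.not_gt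
    · exact absurd ((hF.cover x).1 ⟨q, hq, hxq⟩).2 ((hG.cover x).1 ⟨p, hp, hxp⟩).1.not_gt
    · exact hG.unique p hp q hq x hxp hxq
  cover x := by
    rw [← Set.Ico_union_Ico_eq_Ico hab hbc, Set.mem_union, ← hF.cover, ← hG.cover]
    simp only [Finset.mem_union, or_and_right, exists_or]

theorem exists_of_le_add_one {N a b : ℕ} (hab : a ≤ b) (hba : b ≤ a + 1) (hb : b ≤ N) :
    ∃ F : Finset (ℕ × ℕ), F.card ≤ 1 ∧ IsDyadicPartition N F a b := by
  obtain rfl | rfl : b = a ∨ b = a + 1 := by omega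
  · exact ⟨∅, by simp, by simp, by simp, by simp⟩
  · exact ⟨{(0, a)}, by simp, by simpa using hb, by simp, by simp⟩

theorem mem_Ico_succ_iff (i j x : ℕ) :
    x ∈ Set.Ico (j * 2 ^ (i + 1)) ((j + 1) * 2 ^ (i + 1)) ↔
      x / 2 ∈ Set.Ico (j * 2 ^ i) ((j + 1) * 2 ^ i) := by
  simp only [Set.mem_Ico, pow_succ, ← mul_assoc]
  omega

theorem double {N a b : ℕ} {F : Finset (ℕ × ℕ)} (hF : IsDyadicPartition N F a b) :
    IsDyadicPartition (N * 2) (F.image fun p => (p.1 + 1, p.2)) (a * 2) (b * 2) where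
  le_size := by
    simp only [Finset.forall_mem_image, pow_succ, ← mul_assoc]
    exact fun p hp => Nat.mul_le_mul_right 2 (hF.le_size p hp)
  unique := by
    simp only [Finset.forall_mem_image, mem_Ico_succ_iff]
    intro p hp q hq x hxp hxq
    rw [hF.unique p hp q hq _ hxp hxq]
  cover x := by
    simp only [Finset.exists_mem_image, mem_Ico_succ_iff, hF.cover]
    simp only [Set.mem_Ico]
    omega

theorem exists_card_le (k a b : ℕ) (hab : a ≤ b) (hb : b ≤ 2 ^ k) :
    ∃ F : Finset (ℕ × ℕ), F.card ≤ 2 * k + 1 ∧ IsDyadicPartition (2 ^ k) F a b := by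
  induction k generalizing a b with
  | zero => exact exists_of_le_add_one hab (by simp at hb; omega) hb
  | succ k ih =>
    by_cases h : a = b
    · subst h
      obtain ⟨F, hc, hF⟩ := exists_of_le_add_one le_rfl (Nat.le_succ a) hb
      exact ⟨F, by omega, hF⟩
    rw [pow_succ] at hb ⊢
    obtain ⟨F, hFc, hF⟩ := ih ((a + 1) / 2) (b / 2) (by omega) (by omega)
    obtain ⟨L, hLc, hL⟩ := exists_of_le_add_one (N := 2 ^ k * 2) (a := a) (b := (a + 1) / 2 * 2)
      (by omega) (by omega) (by omega)
    obtain ⟨R, hRc, hR⟩ := exists_of_le_add_one (N := 2 ^ k * 2) (a := b / 2 * 2) (b := b)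
      (by omega) (by omega) hb
    refine ⟨_, ?_, (hL.union (by omega) (by omega) hF.double).union (by omega) (by omega) hR⟩
    grw [Finset.card_union_le, Finset.card_union_le, Finset.card_image_le, hLc, hRc, hFc]
    omega

end IsDyadicPartition

theorem stmt_12 (k a b : ℕ) (hab : a ≤ b) (hb : b ≤ 2 ^ k) :
    ∃ F : Finset (ℕ × ℕ),
      F.card ≤ 2 * k + 1 ∧
      (∀ p ∈ F, (p.2 + 1) * 2 ^ p.1 ≤ 2 ^ k) ∧
      (∀ p ∈ F, ∀ q ∈ F, p ≠ q →
        Disjoint (Set.Ico (p.2 * 2 ^ p.1) ((p.2 + 1) * 2 ^ p.1))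
          (Set.Ico (q.2 * 2 ^ q.1) ((q.2 + 1) * 2 ^ q.1))) ∧
      (⋃ p ∈ F, Set.Ico (p.2 * 2 ^ p.1) ((p.2 + 1) * 2 ^ p.1)) = Set.Ico a b := by
  obtain ⟨F, hc, hF⟩ := IsDyadicPartition.exists_card_le k a b hab hb
  refine ⟨F, hc, hF.le_size, fun p hp q hq hpq => ?_, ?_⟩
  · exact Set.disjoint_left.2 fun x hxp hxq => hpq (hF.unique p hp q hq x hxp hxq)
  · ext x
    simpa only [Set.mem_iUnion, exists_prop] using hF.cover x
end
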